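/- Let I be an open interval containing [0,1] and let f : ℝ → ℝ be twice differentiable on I with a bounded second derivative on I, satisfy f(x) > 2 for all x ∈ I, and satisfy f(0) ≠ f(1). Then for every L > 0 there exists ε ∈ ℝ such that lim_{n→∞} det T_n(f;ε)/G(f)^n = L. -/

import Mathlib

open Filter Topology

/-- The n×n shifted discrete Schrödinger matrix T_n(f;ε) with diagonal entries
f((j−1+ε)/n) for j = 1,…,n and −1 on the first super- and subdiagonals. -/
noncomputable def TmatShift (f : ℝ → ℝ) (ε : ℝ) (n : ℕ) : Matrix (Fin n) (Fin n) ℝ :=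
  Matrix.of fun i j =>
    if (i : ℕ) = (j : ℕ) then f (((i : ℕ) + ε : ℝ) / (n : ℝ))
    else if (i : ℕ) + 1 = (j : ℕ) ∨ (j : ℕ) + 1 = (i : ℕ) then -1 else 0

/-- G(f) = exp ∫₀¹ log((f(x) + √(f(x)² − 4))/2) dx. -/
noncomputable def Gf (f : ℝ → ℝ) : ℝ :=
  Real.exp (∫ x in (0:ℝ)..1, Real.log ((f x + Real.sqrt (f x ^ 2 - 4)) / 2))

/-- The `m × m` tridiagonal matrix with diagonal `d 0, …, d (m - 1)` and off-diagonal entries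
`-1`. -/
def tridiag (d : ℕ → ℝ) (m : ℕ) : Matrix (Fin m) (Fin m) ℝ :=
  Matrix.of fun i j =>
    if (i : ℕ) = (j : ℕ) then d i
    else if (i : ℕ) + 1 = (j : ℕ) ∨ (j : ℕ) + 1 = (i : ℕ) then -1 else 0

theorem det_tridiag_zero (d : ℕ → ℝ) : (tridiag d 0).det = 1 := by simp

theorem det_tridiag_one (d : ℕ → ℝ) : (tridiag d 1).det = d 0 := by simp [tridiag]

theorem det_tridiag_add_two (d : ℕ → ℝ) (m : ℕ) :
    (tridiag d (m + 2)).det = d (m + 1) * (tridiag d (m + 1)).det - (tridiag d m).det := by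
  have hminor : ((tridiag d (m + 2)).submatrix (Fin.last (m + 1)).succAbove
      (Fin.last m).castSucc.succAbove).det = -(tridiag d m).det := by
    have h1 : (Fin.last m).castSucc.succAbove (Fin.last m) = Fin.last (m + 1) := by
      rw [Fin.succAbove_of_le_castSucc _ _ le_rfl]
      rfl
    rw [Matrix.det_succ_column _ (Fin.last m), Fin.sum_univ_castSucc, Finset.sum_eq_zero]
    · have hsub : ((tridiag d (m + 2)).submatrix (Fin.last (m + 1)).succAbove
          (Fin.last m).castSucc.succAbove).submatrix (Fin.last m).succAbove
          (Fin.last m).succAbove = tridiag d m := by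
        ext i j
        have : (Fin.last m).castSucc.succAbove j.castSucc = j.castSucc.castSucc := by
          rw [Fin.succAbove_of_castSucc_lt]
          simp [Fin.lt_def]
        simp [tridiag, this]
      rw [hsub]
      simp [tridiag, h1]
    · intro i _
      have hi := i.isLt
      have h2 : (i : ℕ) ≠ m + 1 := by omega
      have h3 : (i : ℕ) ≠ m := by omega
      have h4 : m + 1 + 1 ≠ (i : ℕ) := by omega
      simp [tridiag, h1, h2, h3, h4]
  rw [Matrix.det_succ_row _ (Fin.last (m + 1)), Fin.sum_univ_castSucc, Fin.sum_univ_castSucc,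
    Finset.sum_eq_zero, hminor]
  · have hsub : (tridiag d (m + 2)).submatrix (Fin.last (m + 1)).succAbove
        (Fin.last (m + 1)).succAbove = tridiag d (m + 1) := by
      ext i j
      simp [tridiag]
    rw [hsub]
    have h1 : tridiag d (m + 2) (Fin.last (m + 1)) (Fin.last m).castSucc = -1 := by
      simp [tridiag]
    have h2 : tridiag d (m + 2) (Fin.last (m + 1)) (Fin.last (m + 1)) = d (m + 1) := by
      simp [tridiag]
    have h3 : ((-1 : ℝ)) ^ (m + 1 + m) = -1 := Odd.neg_one_pow ⟨m, by ring⟩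
    have h4 : ((-1 : ℝ)) ^ (m + 1 + (m + 1)) = 1 := Even.neg_one_pow ⟨m + 1, rfl⟩
    rw [h1, h2]
    simp only [Fin.val_last, Fin.val_castSucc, h3, h4]
    ring
  · intro i _
    have hi := i.isLt
    have h1 : m + 1 ≠ (i : ℕ) := by omega
    have h2 : m + 1 + 1 ≠ (i : ℕ) := by omega
    have h3 : (i : ℕ) ≠ m := by omega
    simp [tridiag, h1, h2, h3]

theorem det_tridiag_pos_and_le {d : ℕ → ℝ} {n : ℕ} (hd : ∀ k ≤ n, 2 ≤ d k) :
    ∀ k ≤ n, 0 < (tridiag d k).det ∧ (tridiag d k).det ≤ (tridiag d (k + 1)).det := by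
  intro k
  induction k with
  | zero =>
    intro _
    rw [det_tridiag_zero, det_tridiag_one]
    exact ⟨one_pos, by linarith [hd 0 (Nat.zero_le n)]⟩
  | succ k ih =>
    intro hk
    obtain ⟨h1, h2⟩ := ih (by omega)
    have h3 := hd (k + 1) hk
    refine ⟨by linarith, ?_⟩
    rw [det_tridiag_add_two]
    nlinarith

/-- One step of the recursion changes `s² (1 - q²)` only by a quadratically small amount plus a
multiple of the decaying component `e`. -/
theorem abs_invariant_step_le {p q s s' e κ δ C B : ℝ} (hp0 : 0 < p) (hp1 : p < 1)
    (hq : 0 < 1 - q ^ 2) (hκ : 1 / (1 - q ^ 2) ≤ κ) (hpq : |p - q| ≤ δ) (hδC : δ ≤ C)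
    (hs : |s| ≤ B) (he : |e| ≤ B) (hs' : |s'| ≤ B)
    (hrec : s' = s * (1 - p * q) / (1 - q ^ 2) + p * (p - q) * e / (1 - q ^ 2)) :
    |s' ^ 2 * (1 - q ^ 2) - s ^ 2 * (1 - p ^ 2)| ≤
      κ * δ ^ 2 * B ^ 2 + (2 * B + κ * C * B) * κ * δ * |e| := by
  have hδ0 : 0 ≤ δ := (abs_nonneg _).trans hpq
  have hB0 : 0 ≤ B := (abs_nonneg _).trans hs
  have hinv : 0 < 1 / (1 - q ^ 2) := one_div_pos.2 hq
  have hκ0 : 0 ≤ κ := hinv.le.trans hκ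
  have hC0 : 0 ≤ C := hδ0.trans hδC
  set η := p * (p - q) * e / (1 - q ^ 2) with hη
  have hηle : |η| ≤ κ * δ * |e| := by
    have : η = (1 / (1 - q ^ 2)) * (p * (p - q) * e) := by
      rw [hη]; ring
    rw [this, abs_mul, abs_mul, abs_mul, abs_of_pos hp0, abs_of_pos hinv]
    have h8 : p * |p - q| ≤ δ := by
      nlinarith [abs_nonneg (p - q)]
    calc 1 / (1 - q ^ 2) * (p * |p - q| * |e|) ≤ κ * (δ * |e|) := by gcongr
      _ = _ := by ring
  have hid : s' ^ 2 * (1 - q ^ 2) - s ^ 2 * (1 - p ^ 2) =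
      1 / (1 - q ^ 2) * ((p - q) ^ 2 * s ^ 2) + (2 * s' - η) * η * (1 - q ^ 2) := by
    clear_value η
    rw [hrec]
    field_simp
    ring
  have hA : |1 / (1 - q ^ 2) * ((p - q) ^ 2 * s ^ 2)| ≤ κ * (δ ^ 2 * B ^ 2) := by
    rw [abs_mul, abs_mul, abs_of_pos hinv, abs_pow, abs_pow]
    gcongr
  have hB1 : |2 * s' - η| ≤ 2 * B + κ * C * B := by
    refine (abs_sub _ _).trans ?_
    rw [abs_mul, abs_two]
    have : κ * δ * |e| ≤ κ * C * B := by gcongr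
    linarith
  have hB2 : |(2 * s' - η) * η * (1 - q ^ 2)| ≤ (2 * B + κ * C * B) * (κ * δ * |e|) * 1 := by
    rw [abs_mul, abs_mul, abs_of_pos hq]
    gcongr
    linarith [sq_nonneg q]
  rw [hid]
  refine (abs_add_le _ _).trans ((add_le_add hA hB2).trans_eq ?_)
  ring

/-- The solution `s + e` of the three-term recursion splits into a slowly varying part `s` and a
decaying part `e`; when the coefficients `q` vary by at most `C / n` per step, the quantity
`s² (1 - q²)` is conserved over `n` steps up to an error of order `1 / n`. -/
theorem exists_adiabatic_bound {ρ C B₀ : ℝ} (hρ1 : ρ < 1) (hC : 0 ≤ C) (hB₀ : 0 ≤ B₀) :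
    ∃ K : ℝ, ∀ n : ℕ, 1 ≤ n → ∀ q s e : ℕ → ℝ,
      (∀ k ≤ n, 0 < q k ∧ q k ≤ ρ) →
      (∀ k < n, |q k - q (k + 1)| ≤ C / n) →
      (∀ k < n, s (k + 1) = s k * (1 - q k * q (k + 1)) / (1 - q (k + 1) ^ 2)
        + q k * (q k - q (k + 1)) * e k / (1 - q (k + 1) ^ 2)) →
      (∀ k < n, e (k + 1) = q k ^ 2 * e k + s k - s (k + 1)) →
      |s 0| + |e 0| ≤ B₀ →
      |s n ^ 2 * (1 - q n ^ 2) - s 0 ^ 2 * (1 - q 0 ^ 2)| ≤ K / n ∧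
      |e n| ≤ K * (ρ ^ 2) ^ n + K / n := by
  set r := ρ ^ 2 with hr
  set κ := 1 / (1 - r) with hκ
  set B := Real.exp (2 * κ * C) * B₀ with hB
  refine ⟨max B (max (κ ^ 2 * C * B)
    (κ * C ^ 2 * B ^ 2 + (2 * B + κ * C * B) * κ * C * (B * κ + κ ^ 2 * C * B))), ?_⟩
  intro n hn q s e hq hδ hs he h0
  have hnpos : (0 : ℝ) < n := by exact_mod_cast hn
  have hρ0 : 0 < ρ := (hq 0 (Nat.zero_le n)).1.trans_le (hq 0 (Nat.zero_le n)).2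
  have hr0 : 0 ≤ r := sq_nonneg ρ
  have hr1 : r < 1 := by rw [hr]; nlinarith
  have hκ0 : 0 < κ := by rw [hκ]; exact one_div_pos.2 (by linarith)
  have hκr : κ * (1 - r) = 1 := by
    rw [hκ]; field_simp [(by linarith : (1 - r) ≠ 0)]
  have hBnn : 0 ≤ B := by positivity
  set δ := C / n with hδdef
  have hδ0 : 0 ≤ δ := by positivity
  have hnδ : n * δ = C := by rw [hδdef]; field_simp
  have hδC : δ ≤ C := by
    have : (1 : ℝ) ≤ n := by exact_mod_cast hn
    nlinarith
  have hqq : ∀ k ≤ n, 0 < 1 - q k ^ 2 ∧ 1 / (1 - q k ^ 2) ≤ κ ∧ q k < 1 ∧ q k ^ 2 ≤ r := by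
    intro k hk
    obtain ⟨h1, h2⟩ := hq k hk
    have h3 : q k ^ 2 ≤ r := by rw [hr]; gcongr
    refine ⟨by linarith, ?_, by linarith, h3⟩
    rw [hκ]
    exact one_div_le_one_div_of_le (by linarith) (by linarith)
  have hdiff : ∀ k < n, |s (k + 1) - s k| ≤ κ * δ * (|s k| + |e k|) := by
    intro k hk
    obtain ⟨h1, h2, h3, -⟩ := hqq (k + 1) (by omega)
    obtain ⟨-, -, h5, -⟩ := hqq k (by omega)
    have h6 := (hq k (by omega)).1
    have h7 := (hq (k + 1) (by omega)).1
    have : s (k + 1) - s k = (1 / (1 - q (k + 1) ^ 2)) * ((q k - q (k + 1)) *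
        (q k * e k - q (k + 1) * s k)) := by
      rw [hs k hk]; field_simp; ring
    rw [this, abs_mul, abs_mul, abs_of_pos (by positivity : 0 < 1 / (1 - q (k + 1) ^ 2)),
      mul_assoc]
    have h8 : |q k * e k - q (k + 1) * s k| ≤ |s k| + |e k| := by
      refine (abs_sub _ _).trans ?_
      rw [abs_mul, abs_mul, abs_of_pos h6, abs_of_pos h7]
      nlinarith [abs_nonneg (s k), abs_nonneg (e k)]
    gcongr
    exact hδ k hk
  have hestep : ∀ k < n, |e (k + 1)| ≤ r * |e k| + κ * δ * (|s k| + |e k|) := by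
    intro k hk
    have h1 : e (k + 1) = q k ^ 2 * e k - (s (k + 1) - s k) := by rw [he k hk]; ring
    rw [h1]
    refine (abs_sub _ _).trans ?_
    rw [abs_mul, abs_of_nonneg (sq_nonneg (q k))]
    have := (hqq k hk.le).2.2.2
    gcongr
    exact hdiff k hk
  have hgrow : ∀ k ≤ n, |s k| + |e k| ≤ (1 + 2 * κ * δ) ^ k * B₀ := by
    intro k
    induction k with
    | zero => intro _; simpa using h0
    | succ k ih =>
      intro hk
      have h1 := ih (by omega)
      have h2 := hdiff k (by omega)
      have h3 := hestep k (by omega)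
      have h4 : |s (k + 1)| ≤ |s k| + |s (k + 1) - s k| := by
        have := abs_add_le (s k) (s (k + 1) - s k)
        simpa using this
      have h5 : r * |e k| ≤ |e k| := by nlinarith [abs_nonneg (e k)]
      calc |s (k + 1)| + |e (k + 1)| ≤ (1 + 2 * κ * δ) * (|s k| + |e k|) := by linarith
        _ ≤ (1 + 2 * κ * δ) * ((1 + 2 * κ * δ) ^ k * B₀) := by gcongr
        _ = _ := by ring
  have hbd : ∀ k ≤ n, |s k| + |e k| ≤ B := by
    intro k hk
    refine (hgrow k hk).trans ?_
    rw [hB]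
    gcongr
    calc (1 + 2 * κ * δ) ^ k ≤ (1 + 2 * κ * δ) ^ n :=
          pow_le_pow_right₀ (by nlinarith [mul_nonneg hκ0.le hδ0]) hk
      _ ≤ (Real.exp (2 * κ * δ)) ^ n := by
          gcongr
          linarith [Real.add_one_le_exp (2 * κ * δ)]
      _ = Real.exp (2 * κ * C) := by
          rw [← Real.exp_nat_mul, ← hnδ]; ring_nf
  have hedecay : ∀ k ≤ n, |e k| ≤ B * r ^ k + κ ^ 2 * δ * B := by
    intro k
    induction k with
    | zero =>
      intro _
      have := hbd 0 (Nat.zero_le n)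
      have h2 : 0 ≤ κ ^ 2 * δ * B := by positivity
      simp only [pow_zero, mul_one]
      linarith [abs_nonneg (s 0)]
    | succ k ih =>
      intro hk
      calc |e (k + 1)| ≤ r * |e k| + κ * δ * (|s k| + |e k|) := hestep k (by omega)
        _ ≤ r * (B * r ^ k + κ ^ 2 * δ * B) + κ * δ * B := by
          gcongr
          · exact ih (by omega)
          · exact hbd k (by omega)
        _ = B * r ^ (k + 1) + κ ^ 2 * δ * B + κ * δ * B * (1 - κ * (1 - r)) := by ring
        _ = _ := by rw [hκr]; ring
  have hZstep : ∀ k < n, |s (k + 1) ^ 2 * (1 - q (k + 1) ^ 2) - s k ^ 2 * (1 - q k ^ 2)| ≤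
      κ * δ ^ 2 * B ^ 2 + (2 * B + κ * C * B) * κ * δ * |e k| := by
    intro k hk
    obtain ⟨h1, h2, h3, -⟩ := hqq (k + 1) (by omega)
    obtain ⟨-, -, h5, -⟩ := hqq k (by omega)
    exact abs_invariant_step_le (hq k (by omega)).1 h5 h1 h2 (hδ k hk) hδC
      (by linarith [hbd k hk.le, abs_nonneg (e k)])
      (by linarith [hbd k hk.le, abs_nonneg (s k)])
      (by linarith [hbd (k + 1) hk, abs_nonneg (e (k + 1))]) (hs k hk)
  have hZ : ∀ k ≤ n, |s k ^ 2 * (1 - q k ^ 2) - s 0 ^ 2 * (1 - q 0 ^ 2)| ≤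
      ∑ i ∈ Finset.range k,
        (κ * δ ^ 2 * B ^ 2 + (2 * B + κ * C * B) * κ * δ * |e i|) := by
    intro k
    induction k with
    | zero => intro _; simp
    | succ k ih =>
      intro hk
      rw [Finset.sum_range_succ]
      refine (abs_sub_le _ (s k ^ 2 * (1 - q k ^ 2)) _).trans ?_
      linarith [ih (by omega), hZstep k (by omega)]
  have hsum : ∑ i ∈ Finset.range n, |e i| ≤ B * κ + κ ^ 2 * C * B := by
    calc ∑ i ∈ Finset.range n, |e i|
        ≤ ∑ i ∈ Finset.range n, (B * r ^ i + κ ^ 2 * δ * B) :=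
          Finset.sum_le_sum fun i hi => hedecay i (Finset.mem_range.1 hi).le
      _ = B * ∑ i ∈ Finset.range n, r ^ i + κ ^ 2 * (n * δ) * B := by
          rw [Finset.sum_add_distrib, ← Finset.mul_sum]; simp; ring
      _ ≤ B * κ + κ ^ 2 * C * B := by
          rw [hnδ]
          gcongr
          have h1 := geom_sum_mul r n
          have h2 : 0 ≤ r ^ n := by positivity
          have h3 : (∑ i ∈ Finset.range n, r ^ i) * (1 - r) ≤ 1 := by linarith
          rw [hκ]
          exact (le_div_iff₀ (by linarith)).2 h3
  constructor
  · refine (hZ n le_rfl).trans ?_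
    rw [Finset.sum_add_distrib, Finset.sum_const, Finset.card_range, nsmul_eq_mul,
      ← Finset.mul_sum]
    calc n * (κ * δ ^ 2 * B ^ 2) + (2 * B + κ * C * B) * κ * δ * ∑ i ∈ Finset.range n, |e i|
        ≤ n * (κ * δ ^ 2 * B ^ 2) + (2 * B + κ * C * B) * κ * δ * (B * κ + κ ^ 2 * C * B) := by
          gcongr
      _ = (κ * C ^ 2 * B ^ 2 + (2 * B + κ * C * B) * κ * C * (B * κ + κ ^ 2 * C * B)) / n := by
          rw [hδdef]; field_simp
      _ ≤ _ := by
          gcongr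
          exact (le_max_right _ _).trans (le_max_right _ _)
  · refine (hedecay n le_rfl).trans ?_
    have h1 : κ ^ 2 * δ * B = (κ ^ 2 * C * B) / n := by rw [hδdef]; ring
    rw [h1]
    gcongr
    · exact le_max_left _ _
    · exact (le_max_left _ _).trans (le_max_right _ _)

/-- Eventually, all the sample points `(k + ε) / n` with `k ≤ n` lie in a given neighbourhood
of `[0, 1]`. -/
theorem eventually_sample_mem_Icc {c d : ℝ} (hc : c < 0) (hd : 1 < d) (ε : ℝ) :
    ∀ᶠ n : ℕ in atTop, ∀ k ≤ n, ((k : ℝ) + ε) / n ∈ Set.Icc c d := by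
  have h := tendsto_const_div_atTop_nhds_zero_nat ε
  filter_upwards [h.eventually (lt_mem_nhds hc),
    h.eventually (gt_mem_nhds (by linarith : 0 < d - 1)), eventually_ge_atTop 1]
    with n h1 h2 hn k hk
  have hnpos : (0 : ℝ) < n := by exact_mod_cast hn
  have h3 : (k : ℝ) / n ≤ 1 := by
    rw [div_le_one hnpos]; exact_mod_cast hk
  have h4 : 0 ≤ (k : ℝ) / n := by positivity
  rw [add_div]
  constructor <;> linarith

theorem tendsto_det_mul_prod {f q : ℝ → ℝ} {c d ρ C : ℝ} (hc : c < 0) (hd : 1 < d)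
    (hρ1 : ρ < 1) (hC : 0 ≤ C)
    (hq : ∀ x ∈ Set.Icc c d, 0 < q x ∧ q x ≤ ρ)
    (hlip : ∀ x ∈ Set.Icc c d, ∀ y ∈ Set.Icc c d, |q x - q y| ≤ C * |x - y|)
    (hfq : ∀ x ∈ Set.Icc c d, f x * q x = 1 + q x ^ 2)
    (hq0 : ContinuousAt q 0) (hq1 : ContinuousAt q 1) (ε : ℝ) :
    Tendsto (fun n : ℕ => (TmatShift f ε n).det * ∏ i ∈ Finset.range n, q ((i + ε) / n)) atTop
      (𝓝 (Real.sqrt (1 / (1 - q 0 ^ 2) / (1 - q 1 ^ 2)))) := by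
  have hz : (0 : ℝ) ∈ Set.Icc c d := ⟨hc.le, by linarith⟩
  have ho : (1 : ℝ) ∈ Set.Icc c d := ⟨by linarith, hd.le⟩
  have hρ0 : 0 < ρ := (hq 0 hz).1.trans_le (hq 0 hz).2
  have hr1 : ρ ^ 2 < 1 := by nlinarith
  have hqsq : ∀ x ∈ Set.Icc c d, q x ^ 2 ≤ ρ ^ 2 := fun x hx => by
    have := (hq x hx).1
    have := (hq x hx).2
    gcongr
  obtain ⟨K, hK⟩ := exists_adiabatic_bound (B₀ := 2 * (1 / (1 - ρ ^ 2)) + 1) hρ1 hC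
    (by have : 0 < 1 / (1 - ρ ^ 2) := one_div_pos.2 (by linarith)
        linarith)
  let D : ℕ → ℕ → ℝ := fun n k => (tridiag (fun i => f ((i + ε) / n)) k).det
  let u : ℕ → ℕ → ℝ := fun n k => D n k * ∏ i ∈ Finset.range k, q ((i + ε) / n)
  let Q : ℕ → ℕ → ℝ := fun n k => q ((k + ε) / n)
  let s : ℕ → ℕ → ℝ := fun n k => (u n (k + 1) - Q n k ^ 2 * u n k) / (1 - Q n k ^ 2)
  change Tendsto (fun n => u n n) atTop _
  have hsamp := eventually_sample_mem_Icc hc hd ε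
  have hpos : ∀ᶠ n : ℕ in atTop, 0 < u n n := by
    filter_upwards [hsamp] with n hn
    refine mul_pos (det_tridiag_pos_and_le (n := n) ?_ n le_rfl).1 ?_
    · intro k hk
      have h1 := hfq _ (hn k hk)
      have h2 := (hq _ (hn k hk)).1
      by_contra! h3
      nlinarith [sq_nonneg (q ((k + ε) / n) - 1)]
    · exact Finset.prod_pos fun i hi => (hq _ (hn i (Finset.mem_range.1 hi).le)).1
  have hmain : ∀ᶠ n : ℕ in atTop,
      |s n n ^ 2 * (1 - Q n n ^ 2) - 1 / (1 - Q n 0 ^ 2)| ≤ K / n ∧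
      |u n n - s n n| ≤ K * (ρ ^ 2) ^ n + K / n := by
    filter_upwards [hsamp, eventually_ge_atTop 1] with n hn hn1
    have hnpos : (0 : ℝ) < n := by exact_mod_cast hn1
    have hQ : ∀ k ≤ n, 0 < 1 - Q n k ^ 2 := fun k hk => by
      have := hqsq _ (hn k hk)
      change 0 < 1 - q ((k + ε) / n) ^ 2
      linarith
    have hu0 : u n 0 = 1 := by simp [u, D]
    have hu1 : u n 1 = 1 + Q n 0 ^ 2 := by
      have := hfq _ (hn 0 (Nat.zero_le n))
      simpa only [u, D, Q, zero_add, det_tridiag_one, Finset.prod_range_one] using this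
    have hu2 : ∀ k < n, u n (k + 2) =
        (1 + Q n (k + 1) ^ 2) * u n (k + 1) - Q n (k + 1) * Q n k * u n k := by
      intro k hk
      have h1 : f (((k + 1 : ℕ) + ε) / n) * Q n (k + 1) = 1 + Q n (k + 1) ^ 2 :=
        hfq _ (hn (k + 1) hk)
      have h2 : D n (k + 2) = f (((k + 1 : ℕ) + ε) / n) * D n (k + 1) - D n k :=
        det_tridiag_add_two _ k
      have h3 : ∀ m, ∏ i ∈ Finset.range (m + 1), q ((i + ε) / n) =
          (∏ i ∈ Finset.range m, q ((i + ε) / n)) * Q n m := fun m => Finset.prod_range_succ _ m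
      simp only [u, h2, h3]
      linear_combination (D n (k + 1) * (∏ i ∈ Finset.range k, q ((i + ε) / n)) * Q n k) * h1
    have hs0 : s n 0 = 1 / (1 - Q n 0 ^ 2) := by
      simp only [s, zero_add, hu0, hu1]
      ring
    have hs0le : 0 < s n 0 ∧ s n 0 ≤ 1 / (1 - ρ ^ 2) := by
      rw [hs0]
      refine ⟨one_div_pos.2 (hQ 0 (Nat.zero_le n)),
        one_div_le_one_div_of_le (by linarith) ?_⟩
      have : Q n 0 ^ 2 ≤ ρ ^ 2 := hqsq _ (hn 0 (Nat.zero_le n))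
      linarith
    have hsw : ∀ k ≤ n, s n k * (1 - Q n k ^ 2) = u n (k + 1) - Q n k ^ 2 * u n k := by
      intro k hk
      exact div_mul_cancel₀ _ (hQ k hk).ne'
    have hsrec : ∀ k < n, s n (k + 1) =
        s n k * (1 - Q n k * Q n (k + 1)) / (1 - Q n (k + 1) ^ 2) +
          Q n k * (Q n k - Q n (k + 1)) * (u n k - s n k) / (1 - Q n (k + 1) ^ 2) := by
      intro k hk
      have h1 := (hQ (k + 1) hk).ne'
      rw [← add_div, eq_div_iff h1, hsw (k + 1) hk, hu2 k hk]
      linear_combination -hsw k hk.le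
    have hconcl := hK n hn1 (Q n) (s n) (fun k => u n k - s n k)
      (fun k hk => hq _ (hn k hk))
      (by
        intro k hk
        refine (hlip _ (hn k hk.le) _ (hn (k + 1) hk)).trans_eq ?_
        have : ((k : ℝ) + ε) / n - (((k + 1 : ℕ) : ℝ) + ε) / n = -(1 / n) := by
          push_cast; field_simp; ring
        rw [this, abs_neg, abs_of_pos (by positivity)]
        ring)
      hsrec
      (by
        intro k hk
        linear_combination -hsw k hk.le)
      (by
        rw [abs_of_pos hs0le.1, hu0]
        have : |1 - s n 0| ≤ 1 + s n 0 := by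
          rw [abs_le]; constructor <;> linarith [hs0le.1]
        linarith [hs0le.2])
    refine ⟨?_, hconcl.2⟩
    have h2 := hconcl.1
    have h3 : s n 0 ^ 2 * (1 - Q n 0 ^ 2) = 1 / (1 - Q n 0 ^ 2) := by
      have := (hQ 0 (Nat.zero_le n)).ne'
      rw [hs0]; field_simp
    rwa [h3] at h2
  have hKn : Tendsto (fun n : ℕ => K / (n : ℝ)) atTop (𝓝 0) :=
    tendsto_const_div_atTop_nhds_zero_nat K
  have hεn := tendsto_const_div_atTop_nhds_zero_nat ε
  have hQ0 : Tendsto (fun n => Q n 0) atTop (𝓝 (q 0)) := by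
    refine hq0.tendsto.comp ?_
    simpa using hεn
  have hQ1 : Tendsto (fun n => Q n n) atTop (𝓝 (q 1)) := by
    refine hq1.tendsto.comp ?_
    have h1 : Tendsto (fun n : ℕ => 1 + ε / (n : ℝ)) atTop (𝓝 1) := by
      simpa using hεn.const_add 1
    refine h1.congr' ?_
    filter_upwards [eventually_ge_atTop 1] with n hn
    have hnpos : (n : ℝ) ≠ 0 := by exact_mod_cast (by omega : n ≠ 0)
    rw [add_div, div_self hnpos]
  have hg0 : 1 - q 0 ^ 2 ≠ 0 := by linarith [hqsq 0 hz]
  have hg1 : 1 - q 1 ^ 2 ≠ 0 := by linarith [hqsq 1 ho]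
  have hg1' : ∀ᶠ n in atTop, 1 - Q n n ^ 2 ≠ 0 :=
    ((hQ1.pow 2).const_sub 1).eventually_ne hg1
  have hdiffZ : Tendsto (fun n => s n n ^ 2 * (1 - Q n n ^ 2) - 1 / (1 - Q n 0 ^ 2)) atTop
      (𝓝 0) :=
    squeeze_zero_norm' (hmain.mono fun n h => h.1) hKn
  have hZ : Tendsto (fun n => s n n ^ 2 * (1 - Q n n ^ 2)) atTop (𝓝 (1 / (1 - q 0 ^ 2))) := by
    have := hdiffZ.add ((tendsto_const_nhds (x := (1 : ℝ))).div ((hQ0.pow 2).const_sub 1) hg0)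
    simpa using this
  have hs2 : Tendsto (fun n => s n n ^ 2) atTop (𝓝 (1 / (1 - q 0 ^ 2) / (1 - q 1 ^ 2))) := by
    refine (hZ.div ((hQ1.pow 2).const_sub 1) hg1).congr' ?_
    filter_upwards [hg1'] with n hn
    exact mul_div_cancel_right₀ _ hn
  have hsabs : Tendsto (fun n => |s n n|) atTop
      (𝓝 (Real.sqrt (1 / (1 - q 0 ^ 2) / (1 - q 1 ^ 2)))) := by
    simpa [Real.sqrt_sq_eq_abs] using hs2.sqrt
  have hE : Tendsto (fun n => u n n - s n n) atTop (𝓝 0) := by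
    refine squeeze_zero_norm' (hmain.mono fun n h => h.2) ?_
    simpa using ((tendsto_pow_atTop_nhds_zero_of_lt_one (sq_nonneg ρ) hr1).const_mul K).add hKn
  have hE' : Tendsto (fun n => |u n n| - |s n n|) atTop (𝓝 0) :=
    squeeze_zero_norm (fun n => abs_abs_sub_abs_le_abs_sub (u n n) (s n n)) (by simpa using hE.abs)
  have hlim := hE'.add hsabs
  rw [zero_add] at hlim
  refine hlim.congr' ?_
  filter_upwards [hpos] with n hn
  rw [abs_of_pos hn]
  ring

/-- Euler–Maclaurin asymptotics up to `o(1)` for shifted Riemann sums of a `C¹` function. -/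
theorem tendsto_sum_shift_sub_integral {φ φ' : ℝ → ℝ} {c d : ℝ} (hc : c < 0) (hd : 1 < d)
    (hφ : ∀ x ∈ Set.Icc c d, HasDerivAt φ (φ' x) x) (hφ' : ContinuousOn φ' (Set.Icc c d))
    (ε : ℝ) :
    Tendsto (fun n : ℕ => ∑ i ∈ Finset.range n, φ ((i + ε) / n) - n * ∫ x in (0:ℝ)..1, φ x)
      atTop (𝓝 ((ε - 1 / 2) * (φ 1 - φ 0))) := by
  have huc := isCompact_Icc.uniformContinuousOn_of_continuous hφ'
  have hcont : ContinuousOn φ (Set.Icc c d) := fun x hx => (hφ x hx).continuousAt.continuousWithinAt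
  rw [Metric.tendsto_atTop']
  intro η₀ hη₀
  set η := η₀ / (2 * |ε| + 3) with hη
  have hηpos : 0 < η := by positivity
  obtain ⟨δ, hδ, hδη⟩ := Metric.uniformContinuousOn_iff.1 huc η hηpos
  have hlin : ∀ x ∈ Set.Icc c d, ∀ y ∈ Set.Icc c d, |y - x| < δ →
      |φ y - φ x - (y - x) * φ' x| ≤ η * |y - x| := by
    intro x hx y hy hxy
    have hsub : Set.uIcc x y ⊆ Set.Icc c d := Set.uIcc_subset_Icc hx hy
    have := (convex_uIcc x y).norm_image_sub_le_of_norm_hasDerivWithin_le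
      (f := fun t => φ t - t * φ' x) (f' := fun t => φ' t - φ' x) (C := η) (x := x) (y := y)
      (fun t ht => by
        have h := ((hφ t (hsub ht)).sub ((hasDerivAt_id t).mul_const (φ' x))).hasDerivWithinAt
          (s := Set.uIcc x y)
        rw [one_mul] at h
        exact h)
      (fun t ht => by
        refine (hδη t (hsub ht) x hx ?_).le
        rw [Real.dist_eq]
        exact (Set.abs_sub_left_of_mem_uIcc ht).trans_lt hxy)
      Set.left_mem_uIcc Set.right_mem_uIcc
    rw [Real.norm_eq_abs, Real.norm_eq_abs] at this
    convert this using 2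
    ring
  obtain ⟨N, hN⟩ := eventually_atTop.1 ((eventually_sample_mem_Icc hc hd ε).and
    ((eventually_ge_atTop 1).and ((tendsto_const_div_atTop_nhds_zero_nat (|ε| + 1)).eventually
      (gt_mem_nhds hδ))))
  refine ⟨N, fun n hn => ?_⟩
  obtain ⟨hsamp, hn1, hnδ⟩ := hN n hn.le
  have hnpos : (0 : ℝ) < n := by exact_mod_cast hn1
  set h : ℝ := 1 / n with hh
  have hhpos : 0 < h := by positivity
  have hnh : n * h = 1 := by rw [hh]; field_simp
  have hhδ : h < δ ∧ |ε| * h < δ := by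
    have h1 : (|ε| + 1) * h < δ := by rw [hh]; simpa [div_eq_mul_inv] using hnδ
    have h2 : 0 ≤ |ε| * h := by positivity
    constructor <;> linarith
  have hmem : ∀ k ≤ n, (k : ℝ) * h ∈ Set.Icc c d ∧ (k : ℝ) * h ∈ Set.Icc (0 : ℝ) 1 := by
    intro k hk
    have h1 : (k : ℝ) * h ≤ 1 := by
      rw [← hnh]; gcongr
    have h2 : 0 ≤ (k : ℝ) * h := by positivity
    exact ⟨⟨by linarith, by linarith⟩, h2, h1⟩
  have hint : ∀ x ∈ Set.Icc c d, ∀ y ∈ Set.Icc c d, IntervalIntegrable φ MeasureTheory.volume x y :=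
    fun x hx y hy => (hcont.mono (Set.uIcc_subset_Icc hx hy)).intervalIntegrable
  have hterm : ∀ k < n, |φ ((k + ε) / n) - n * (∫ x in (k * h)..((k + 1 : ℕ) * h), φ x)
      - (ε - 1 / 2) * (φ ((k + 1 : ℕ) * h) - φ (k * h))| ≤ η * h * (2 * |ε| + 2) := by
    intro k hk
    have hx := (hmem k hk.le).1
    have hy := (hmem (k + 1) hk).1
    set x : ℝ := k * h with hxdef
    have hy' : ((k + 1 : ℕ) : ℝ) * h = x + h := by push_cast; ring
    rw [hy'] at hy ⊢
    have hz := hsamp k hk.le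
    have hz' : ((k : ℝ) + ε) / n = x + ε * h := by rw [hxdef, hh]; ring
    rw [hz'] at hz ⊢
    have h1 := hlin x hx _ hz (by
      rw [add_sub_cancel_left, abs_mul, abs_of_pos hhpos]; exact hhδ.2)
    have h2 := hlin x hx _ hy (by rw [add_sub_cancel_left, abs_of_pos hhpos]; exact hhδ.1)
    rw [add_sub_cancel_left, abs_mul, abs_of_pos hhpos] at h1
    rw [add_sub_cancel_left, abs_of_pos hhpos] at h2
    have h3 : |∫ t in x..(x + h), (φ t - φ x - (t - x) * φ' x)| ≤ η * h * |x + h - x| := by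
      rw [← Real.norm_eq_abs]
      refine intervalIntegral.norm_integral_le_of_norm_le_const fun t ht => ?_
      rw [Set.uIoc_of_le (by linarith)] at ht
      have htm : t ∈ Set.Icc c d := ⟨by linarith [hx.1, ht.1], by linarith [hy.2, ht.2]⟩
      have h4 : |t - x| ≤ h := by rw [abs_le]; constructor <;> linarith [ht.1, ht.2]
      refine (hlin x hx t htm (h4.trans_lt hhδ.1)).trans ?_
      gcongr
    have h4 : ∫ t in x..(x + h), (φ t - φ x - (t - x) * φ' x) =
        (∫ t in x..(x + h), φ t) - h * φ x - h ^ 2 / 2 * φ' x := by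
      have hlinint : ∫ t in x..(x + h), (t - x) * φ' x = h ^ 2 / 2 * φ' x := by
        rw [intervalIntegral.integral_mul_const, intervalIntegral.integral_sub
          (by simp) (by simp)]
        simp only [integral_id, intervalIntegral.integral_const, smul_eq_mul]
        ring
      rw [intervalIntegral.integral_sub ((hint _ hx _ hy).sub (by simp))
        (Continuous.intervalIntegrable (by fun_prop) _ _),
        intervalIntegral.integral_sub (hint _ hx _ hy) (by simp), hlinint]
      simp
    rw [h4, add_sub_cancel_left, abs_of_pos hhpos] at h3
    set J := ∫ t in x..(x + h), φ t
    have h5 : |n * (J - h * φ x - h ^ 2 / 2 * φ' x)| ≤ η * h := by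
      rw [abs_mul, abs_of_pos hnpos]
      calc n * |J - h * φ x - h ^ 2 / 2 * φ' x| ≤ n * (η * h * h) := by gcongr
        _ = η * h * (n * h) := by ring
        _ = η * h := by rw [hnh, mul_one]
    have h6 : |(ε - 1 / 2) * (φ (x + h) - φ x - h * φ' x)| ≤ (|ε| + 1 / 2) * (η * h) := by
      rw [abs_mul]
      gcongr
      refine (abs_sub _ _).trans_eq ?_
      norm_num
    have h7 : φ (x + ε * h) - n * J - (ε - 1 / 2) * (φ (x + h) - φ x) =
        (φ (x + ε * h) - φ x - ε * h * φ' x) - n * (J - h * φ x - h ^ 2 / 2 * φ' x)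
          - (ε - 1 / 2) * (φ (x + h) - φ x - h * φ' x) := by
      linear_combination (-(φ x) - h / 2 * φ' x) * hnh
    rw [h7]
    refine ((abs_sub _ _).trans (add_le_add_left (abs_sub _ _) _)).trans ?_
    have h8 : 0 < η * h := by positivity
    linarith
  have hI : ∑ k ∈ Finset.range n, (∫ x in ((k : ℕ) * h)..((k + 1 : ℕ) * h), φ x) =
      ∫ x in (0:ℝ)..1, φ x := by
    have := intervalIntegral.sum_integral_adjacent_intervals (f := φ) (μ := MeasureTheory.volume)
      (a := fun k : ℕ => (k : ℝ) * h) (n := n)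
      (fun k hk => hint _ (hmem k hk.le).1 _ (hmem (k + 1) hk).1)
    simpa [hnh] using this
  have hT : ∑ k ∈ Finset.range n, (φ ((k + 1 : ℕ) * h) - φ ((k : ℕ) * h)) = φ 1 - φ 0 := by
    rw [Finset.sum_range_sub (fun k : ℕ => φ (k * h))]
    simp [hnh]
  rw [Real.dist_eq, ← hI, ← hT, Finset.mul_sum, Finset.mul_sum, ← Finset.sum_sub_distrib,
    ← Finset.sum_sub_distrib]
  calc _ ≤ ∑ k ∈ Finset.range n, η * h * (2 * |ε| + 2) :=
        (Finset.abs_sum_le_sum_abs _ _).trans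
          (Finset.sum_le_sum fun k hk => hterm k (Finset.mem_range.1 hk))
    _ = η * (2 * |ε| + 2) * (n * h) := by simp; ring
    _ < η * (2 * |ε| + 3) := by rw [hnh]; linarith
    _ = η₀ := by rw [hη]; field_simp

theorem inv_add_sqrt_div_two {y : ℝ} (hy : 2 < y) :
    ((y + Real.sqrt (y ^ 2 - 4)) / 2)⁻¹ = (y - Real.sqrt (y ^ 2 - 4)) / 2 := by
  have h : Real.sqrt (y ^ 2 - 4) ^ 2 = y ^ 2 - 4 := Real.sq_sqrt (by nlinarith)
  refine inv_eq_of_mul_eq_one_right ?_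
  linear_combination -h / 4

/-- If f(0) ≠ f(1), then by choosing the shift ε the limit of det T_n(f;ε)/G(f)ⁿ can be
made equal to any positive number L. -/
theorem shift_realizes_any_positive_limit (a b : ℝ) (hI : Set.Icc (0:ℝ) 1 ⊆ Set.Ioo a b)
    (f f' f'' : ℝ → ℝ)
    (hd1 : ∀ x ∈ Set.Ioo a b, HasDerivAt f (f' x) x)
    (hd2 : ∀ x ∈ Set.Ioo a b, HasDerivAt f' (f'' x) x)
    (hbd : ∃ M : ℝ, ∀ x ∈ Set.Ioo a b, |f'' x| ≤ M)
    (hf2 : ∀ x ∈ Set.Ioo a b, 2 < f x)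
    (hne : f 0 ≠ f 1) :
    ∀ L : ℝ, 0 < L → ∃ ε : ℝ,
      Tendsto (fun n : ℕ => (TmatShift f ε n).det / (Gf f) ^ n) atTop (𝓝 L) := by
  intro L hL
  have ha : a < 0 := (hI ⟨le_rfl, zero_le_one⟩).1
  have hb : 1 < b := (hI ⟨zero_le_one, le_rfl⟩).2
  obtain ⟨c, hac, hc⟩ := exists_between ha
  obtain ⟨d, hd, hdb⟩ := exists_between hb
  have hsub : Set.Icc c d ⊆ Set.Ioo a b := Set.Icc_subset_Ioo hac hdb
  have hz : (0 : ℝ) ∈ Set.Icc c d := ⟨hc.le, by linarith⟩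
  have ho : (1 : ℝ) ∈ Set.Icc c d := ⟨by linarith, hd.le⟩
  set φ : ℝ → ℝ := fun x => Real.log ((f x + Real.sqrt (f x ^ 2 - 4)) / 2) with hφdef
  have hsq : ∀ x ∈ Set.Icc c d, 0 < f x ^ 2 - 4 := fun x hx => by nlinarith [hf2 x (hsub hx)]
  have hlam : ∀ x ∈ Set.Icc c d, 1 < (f x + Real.sqrt (f x ^ 2 - 4)) / 2 := fun x hx => by
    linarith [hf2 x (hsub hx), Real.sqrt_nonneg (f x ^ 2 - 4)]
  have hφpos : ∀ x ∈ Set.Icc c d, 0 < φ x := fun x hx => Real.log_pos (hlam x hx)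
  have hexp : ∀ x ∈ Set.Icc c d, Real.exp (φ x) = (f x + Real.sqrt (f x ^ 2 - 4)) / 2 :=
    fun x hx => Real.exp_log (by linarith [hlam x hx])
  have hfexp : ∀ x ∈ Set.Icc c d, f x = Real.exp (φ x) + Real.exp (-φ x) := fun x hx => by
    rw [Real.exp_neg, hexp x hx, inv_add_sqrt_div_two (hf2 x (hsub hx))]
    ring
  have hfc : ContinuousOn f (Set.Icc c d) :=
    fun x hx => (hd1 x (hsub hx)).continuousAt.continuousWithinAt
  have hf'c : ContinuousOn f' (Set.Icc c d) :=
    fun x hx => (hd2 x (hsub hx)).continuousAt.continuousWithinAt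
  set φ' : ℝ → ℝ := fun x => f' x / Real.sqrt (f x ^ 2 - 4) with hφ'def
  have hφ : ∀ x ∈ Set.Icc c d, HasDerivAt φ (φ' x) x := by
    intro x hx
    have h1 := hd1 x (hsub hx)
    have h2 := ((h1.add (((h1.pow 2).sub_const 4).sqrt (hsq x hx).ne')).div_const 2).log
      (by simpa using (by linarith [hlam x hx] : (f x + Real.sqrt (f x ^ 2 - 4)) / 2 ≠ 0))
    refine h2.congr_deriv ?_
    have h3 : Real.sqrt (f x ^ 2 - 4) ≠ 0 := (Real.sqrt_pos.2 (hsq x hx)).ne'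
    have h4 : f x + Real.sqrt (f x ^ 2 - 4) ≠ 0 := by linarith [hlam x hx]
    simp [hφ'def]
    field_simp
    ring
  have hφ'c : ContinuousOn φ' (Set.Icc c d) :=
    hf'c.div ((hfc.pow 2).sub continuousOn_const).sqrt
      fun x hx => (Real.sqrt_pos.2 (hsq x hx)).ne'
  set q : ℝ → ℝ := fun x => Real.exp (-φ x) with hqdef
  have hq : ∀ x ∈ Set.Icc c d, HasDerivAt q (Real.exp (-φ x) * -φ' x) x :=
    fun x hx => (hφ x hx).neg.exp
  have hφc : ContinuousOn φ (Set.Icc c d) :=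
    fun x hx => (hφ x hx).continuousAt.continuousWithinAt
  obtain ⟨x₀, hx₀, hmax⟩ := isCompact_Icc.exists_isMaxOn ⟨0, hz⟩ hφc.neg.rexp
  obtain ⟨C, hC⟩ := isCompact_Icc.exists_bound_of_continuousOn (hφc.neg.rexp.mul hφ'c.neg)
  have hC0 : 0 ≤ C := (norm_nonneg _).trans (hC 0 hz)
  set S := Real.sqrt (1 / (1 - q 0 ^ 2) / (1 - q 1 ^ 2))
  have hdet : ∀ ε : ℝ, Tendsto (fun n : ℕ =>
      (TmatShift f ε n).det * ∏ i ∈ Finset.range n, q ((i + ε) / n)) atTop (𝓝 S) :=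
    tendsto_det_mul_prod (f := f) (q := q) hc hd (ρ := q x₀) (C := C)
      (Real.exp_lt_one_iff.2 (by linarith [hφpos x₀ hx₀])) hC0
      (fun x hx => ⟨Real.exp_pos _, hmax hx⟩)
      (fun x hx y hy => (convex_Icc c d).norm_image_sub_le_of_norm_hasDerivWithin_le
        (fun t ht => (hq t ht).hasDerivWithinAt) hC hy hx)
      (fun x hx => by
        have h1 : Real.exp (φ x) * q x = 1 := by rw [hqdef]; simp [← Real.exp_add]
        have h2 : f x = Real.exp (φ x) + q x := hfexp x hx
        rw [h2]; linear_combination h1)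
      (hq 0 hz).continuousAt (hq 1 ho).continuousAt
  have hSpos : 0 < S := by
    have hlt : ∀ x ∈ Set.Icc c d, 0 < 1 - q x ^ 2 := fun x hx => by
      have h1 : q x < 1 := Real.exp_lt_one_iff.2 (by linarith [hφpos x hx])
      have h2 : 0 < q x := Real.exp_pos _
      nlinarith
    have h0 := hlt 0 hz
    have h1 := hlt 1 ho
    positivity
  have hΔ : φ 1 - φ 0 ≠ 0 := by
    intro h
    apply hne
    rw [hfexp 0 hz, hfexp 1 ho, sub_eq_zero.1 h]
  refine ⟨1 / 2 + Real.log (L / S) / (φ 1 - φ 0), ?_⟩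
  set ε := 1 / 2 + Real.log (L / S) / (φ 1 - φ 0) with hε
  have hlim := (hdet ε).mul (tendsto_sum_shift_sub_integral hc hd hφ hφ'c ε).rexp
  have hval : S * Real.exp ((ε - 1 / 2) * (φ 1 - φ 0)) = L := by
    rw [hε, add_sub_cancel_left, div_mul_cancel₀ _ hΔ, Real.exp_log (by positivity)]
    field_simp
  rw [hval] at hlim
  refine hlim.congr fun n => ?_
  have hG : Gf f ^ n = Real.exp (n * ∫ x in (0:ℝ)..1, φ x) := by
    rw [Real.exp_nat_mul]; rfl
  have hprod : (∏ i ∈ Finset.range n, q ((i + ε) / n)) *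
      Real.exp (∑ i ∈ Finset.range n, φ ((i + ε) / n)) = 1 := by
    rw [Real.exp_sum, ← Finset.prod_mul_distrib]
    exact Finset.prod_eq_one fun i _ => by simp [hqdef, ← Real.exp_add]
  rw [hG, Real.exp_sub, mul_div_assoc', mul_assoc, hprod, mul_one]
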